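/- Let λ ≥ 0, β > 0 and γ > 0, let u be the global radial solution of u''(r) + u'(r)/r = −(λ u(r) + β u(r) exp(u(r)²)) with u(0) = γ, u'(0) = 0, and let R ∈ (0,+∞) be the first zero of u. Then λ + β < λ₁/R². (In particular R → 0 as β → +∞.) -/

import Mathlib

open Real Set Filter MeasureTheory

noncomputable section

/-- The radial Laplacian with the sign convention Δ = −div(∇·):
for a radial C² function, (Δu)(r) = −u''(r) − u'(r)/r. -/
def radLap (u : ℝ → ℝ) (r : ℝ) : ℝ := -(deriv (deriv u) r) - deriv u r / r

/-- `EigenCtx lam1 v1` : λ₁ > 0 is the first radial Dirichlet eigenvalue of Δ = −div∇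
on the unit disk, with radial eigenfunction v₁: v₁ is smooth on [0,1], Δv₁ = λ₁v₁ in Ω,
v₁ > 0 in Ω, v₁(1) = 0 and ∫_Ω v₁² dy = ∫₀¹ v₁(r)² 2πr dr = 1. -/
def EigenCtx (lam1 : ℝ) (v1 : ℝ → ℝ) : Prop :=
  0 < lam1 ∧ ContDiffOn ℝ (⊤ : ℕ∞) v1 (Set.Icc 0 1) ∧
    (∀ r ∈ Set.Ioo (0:ℝ) 1, radLap v1 r = lam1 * v1 r) ∧
    (∀ r ∈ Set.Ico (0:ℝ) 1, 0 < v1 r) ∧ v1 1 = 0 ∧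
    (∫ r in Set.Ioo (0:ℝ) 1, (v1 r) ^ 2 * (2 * π * r)) = 1

/-- The derivative within `s` of a function that is `C²` on `s` is differentiable at interior
points, with derivative the second derivative. -/
theorem hasDerivAt_derivWithin_of_contDiffOn_two {f : ℝ → ℝ} {s : Set ℝ} {x : ℝ}
    (hf : ContDiffOn ℝ 2 f s) (hx : s ∈ nhds x) :
    HasDerivAt f (deriv f x) x ∧ HasDerivAt (derivWithin f s) (deriv (deriv f) x) x := by
  have hfx : ContDiffAt ℝ 2 f x := hf.contDiffAt hx
  have hdiff : DifferentiableAt ℝ (deriv f) x :=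
    (hfx.derivWithin (m := 1) (by norm_num)).differentiableAt (by norm_num)
  refine ⟨(hfx.differentiableAt (by norm_num)).hasDerivAt,
    hdiff.hasDerivAt.congr_of_eventuallyEq ?_⟩
  filter_upwards [eventually_mem_nhds_iff.2 hx] with y hy
  exact derivWithin_of_mem_nhds hy

/-- If u is the global radial solution of
u'' + u'/r = −(λu + βu e^{u²}) with u(0) = γ > 0, u'(0) = 0 (λ ≥ 0, β > 0), and
R ∈ (0,∞) is its first zero, then λ + β < λ₁/R². -/
theorem statement2 (lam1 : ℝ) (v1 : ℝ → ℝ) (hE : EigenCtx lam1 v1)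
    (lam beta gam : ℝ) (hlam : 0 ≤ lam) (hbeta : 0 < beta) (hgam : 0 < gam)
    (u : ℝ → ℝ)
    (hreg : ContDiffOn ℝ 2 u (Set.Ici 0))
    (hu0 : u 0 = gam)
    (hu'0 : derivWithin u (Set.Ici 0) 0 = 0)
    (hode : ∀ r : ℝ, 0 < r →
      deriv (deriv u) r + deriv u r / r
        = -(lam * u r + beta * u r * Real.exp ((u r) ^ 2)))
    (R : ℝ) (hR : 0 < R)
    (hpos : ∀ r ∈ Set.Ico (0:ℝ) R, 0 < u r) (hRzero : u R = 0) :
    lam + beta < lam1 / R ^ 2 := by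
  obtain ⟨-, hv, hvode, hvpos, hv1, -⟩ := hE
  have hv2 : ContDiffOn ℝ 2 v1 (Icc 0 1) := hv.of_le (WithTop.coe_le_coe.2 le_top)
  by_contra! hle
  rw [div_le_iff₀ (by positivity)] at hle
  -- the weighted Wronskian of `s ↦ u (R s)` and `v1`
  let W : ℝ → ℝ := fun s ↦ s * (R * derivWithin u (Ici 0) (R * s) * v1 s
    - u (R * s) * derivWithin v1 (Icc 0 1) s)
  have hmaps : MapsTo (fun s : ℝ ↦ R * s) (Icc 0 1) (Ici 0) :=
    fun s hs ↦ mul_nonneg hR.le hs.1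
  have hmul : ContinuousOn (fun s : ℝ ↦ R * s) (Icc 0 1) := by fun_prop
  have hWcont : ContinuousOn W (Icc 0 1) := by
    have hu' := (hreg.continuousOn_derivWithin (uniqueDiffOn_Ici 0) (by norm_num)).comp hmul hmaps
    have hu := hreg.continuousOn.comp hmul hmaps
    have hv' := hv2.continuousOn_derivWithin (uniqueDiffOn_Icc zero_lt_one) (by norm_num)
    exact continuousOn_id.mul (((continuousOn_const.mul hu').mul hv2.continuousOn).sub (hu.mul hv'))
  have hWneg : ∀ s ∈ interior (Icc (0 : ℝ) 1), deriv W s < 0 := by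
    rw [interior_Icc]
    intro s hs
    have hRs : 0 < R * s := mul_pos hR hs.1
    have hIci : Ici (0 : ℝ) ∈ nhds (R * s) := Ici_mem_nhds hRs
    have hIcc : Icc (0 : ℝ) 1 ∈ nhds s := Icc_mem_nhds hs.1 hs.2
    obtain ⟨hu, hu'⟩ := hasDerivAt_derivWithin_of_contDiffOn_two hreg hIci
    obtain ⟨hvs, hv's⟩ := hasDerivAt_derivWithin_of_contDiffOn_two hv2 hIcc
    have hscale : HasDerivAt (fun t : ℝ ↦ R * t) R s := by
      simpa using (hasDerivAt_id s).const_mul R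
    have hW := (hasDerivAt_id s).mul
      ((((hu'.comp s hscale).const_mul R).mul hvs).sub ((hu.comp s hscale).mul hv's))
    have hWs : deriv W s = _ := hW.deriv
    have hupos : 0 < u (R * s) := hpos _ ⟨hRs.le, by nlinarith [hs.2]⟩
    have hvspos : 0 < v1 s := hvpos s ⟨hs.1.le, hs.2⟩
    have hexp : 1 < Real.exp (u (R * s) ^ 2) := Real.one_lt_exp_iff.2 (by positivity)
    have hcoef : lam1 - R ^ 2 * (lam + beta * Real.exp (u (R * s) ^ 2)) < 0 := by
      have : 0 < R ^ 2 * beta * (Real.exp (u (R * s) ^ 2) - 1) :=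
        mul_pos (by positivity) (by linarith)
      linarith
    have huode := hode (R * s) hRs
    have hvodes := hvode s hs
    unfold radLap at hvodes
    have hs0 : s ≠ 0 := hs.1.ne'
    have hkey : deriv W s = s * u (R * s) * v1 s *
        (lam1 - R ^ 2 * (lam + beta * Real.exp (u (R * s) ^ 2))) := by
      have hu2 : deriv (deriv u) (R * s) = -(lam * u (R * s)
          + beta * u (R * s) * Real.exp (u (R * s) ^ 2)) - deriv u (R * s) / (R * s) := by linarith
      have hv2s : deriv (deriv v1) s = -(lam1 * v1 s) - deriv v1 s / s := by linarith
      rw [hWs]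
      simp only [Function.comp_apply, id, Pi.mul_apply, Pi.sub_apply,
        derivWithin_of_mem_nhds hIci, derivWithin_of_mem_nhds hIcc, hu2, hv2s]
      field_simp
      ring
    rw [hkey]
    exact mul_neg_of_pos_of_neg (mul_pos (mul_pos hs.1 hupos) hvspos) hcoef
  have hlt := strictAntiOn_of_deriv_neg (convex_Icc 0 1) hWcont hWneg
    (left_mem_Icc.2 zero_le_one) (right_mem_Icc.2 zero_le_one) zero_lt_one
  simp [W, hv1, hRzero] at hlt

end
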